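/- Let Q be a full union of conjunctive queries with negation and inequalities (full UCQ¬,≠) with disjuncts Q₁,…,Q_m over schema σ, and let ρ = (U, rfacts_ρ) be a distribution policy over σ and network N. Then Q is not parallel-complete under ρ if and only if there exist an instance I of facts over σ with values from U with |I| ≤ max_{j∈{1,…,m}} |pos(Qⱼ)| + |N|·m and a fact f such that f ∈ Q(I) and, for every node κ ∈ N, f ∉ Q(dist_{ρ,I}(κ)). -/

import Mathlib

/-- An atom `R(x₁,…,x_k)`: a relation name together with a tuple of variables. -/
structure Atom (R V : Type) where
  rel : R
  args : List V
deriving DecidableEq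

/-- A fact `R(t)`: a relation name together with a tuple of data values. -/
structure DBFact (R D : Type) where
  rel : R
  args : List D
deriving DecidableEq

/-- Applying a valuation to an atom yields a fact. -/
def Atom.app {R V D : Type} (f : V → D) (a : Atom R V) : DBFact R D :=
  ⟨a.rel, a.args.map f⟩

/-- The variables occurring in an atom. -/
def Atom.vars {R V : Type} (a : Atom R V) : Set V := {v | v ∈ a.args}

/-- A conjunctive query with negation and inequalities (CQ¬,≠): a head atom,
finite sets of positive and negated body atoms, and a finite set of
inequalities between variables. -/
structure CQ (R V : Type) where
  head : Atom R V
  pos : Finset (Atom R V)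
  neg : Finset (Atom R V)
  ineq : Finset (V × V)

namespace CQ

variable {R V D : Type}

/-- The variables occurring in a query. -/
def vars (Q : CQ R V) : Set V :=
  Q.head.vars ∪ (⋃ a ∈ (↑Q.pos : Set (Atom R V)), a.vars) ∪
    (⋃ a ∈ (↑Q.neg : Set (Atom R V)), a.vars) ∪
    (⋃ p ∈ (↑Q.ineq : Set (V × V)), {p.1, p.2})

/-- Safety: every head variable and every variable of a negated atom occurs in
some positive atom. -/
def safe (Q : CQ R V) : Prop :=
  (∀ v ∈ Q.head.vars, ∃ a ∈ Q.pos, v ∈ a.args) ∧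
  (∀ a ∈ Q.neg, ∀ v ∈ a.args, ∃ b ∈ Q.pos, v ∈ b.args)

/-- A query is full if every one of its variables occurs in its head atom. -/
def isFull (Q : CQ R V) : Prop := ∀ v ∈ Q.vars, v ∈ Q.head.args

/-- The facts required by a valuation `f`: `f(pos(Q))`. -/
def posFacts (Q : CQ R V) (f : V → D) : Set (DBFact R D) :=
  Atom.app f '' (↑Q.pos : Set (Atom R V))

/-- The facts prohibited by a valuation `f`: `f(neg(Q))`. -/
def negFacts (Q : CQ R V) (f : V → D) : Set (DBFact R D) :=
  Atom.app f '' (↑Q.neg : Set (Atom R V))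

/-- `f` is a valuation for `Q`: required and prohibited facts are disjoint and
all inequalities are respected. -/
def isVal (Q : CQ R V) (f : V → D) : Prop :=
  Q.posFacts f ∩ Q.negFacts f = ∅ ∧
  ∀ p ∈ Q.ineq, f p.1 ≠ f p.2

/-- `f` satisfies `Q` on `I`: all required facts are in `I` and no prohibited
fact is in `I`. -/
def sat (Q : CQ R V) (f : V → D) (I : Set (DBFact R D)) : Prop :=
  Q.posFacts f ⊆ I ∧ Q.negFacts f ∩ I = ∅

/-- `Q(I)`: the set of facts derived on `I` by valuations satisfying `Q`. -/
def eval (Q : CQ R V) (I : Set (DBFact R D)) : Set (DBFact R D) :=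
  {fc | ∃ f : V → D, Q.isVal f ∧ Q.sat f I ∧ Atom.app f Q.head = fc}

end CQ

/-- A union of conjunctive queries (with negation and inequalities): a finite,
nonempty family of CQ¬,≠s. -/
structure UCQ (R V : Type) where
  n : ℕ
  npos : 0 < n
  disj : Fin n → CQ R V

namespace UCQ

variable {R V D : Type}

/-- Well-formedness of a UCQ: every disjunct is safe, all disjuncts have the
same head relation, and distinct disjuncts have disjoint variable sets. -/
def wf (Q : UCQ R V) : Prop :=
  (∀ i, (Q.disj i).safe) ∧
  (∀ i j, (Q.disj i).head.rel = (Q.disj j).head.rel) ∧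
  (∀ i j, i ≠ j → Disjoint (Q.disj i).vars (Q.disj j).vars)

/-- `Q(I) = ⋃ᵢ Qᵢ(I)`. -/
def eval (Q : UCQ R V) (I : Set (DBFact R D)) : Set (DBFact R D) :=
  ⋃ i, (Q.disj i).eval I

/-- The maximum number of variables of any disjunct. -/
noncomputable def varmax (Q : UCQ R V) : ℕ :=
  Finset.univ.sup fun i => ((Q.disj i).vars).ncard

end UCQ

/-- The values of the fact all belong to `U`. -/
def DBFact.valsIn {R D : Type} (fc : DBFact R D) (U : Set D) : Prop :=
  ∀ d ∈ fc.args, d ∈ U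

/-- The active domain of an instance: all data values occurring in it. -/
def adom {R D : Type} (I : Set (DBFact R D)) : Set D :=
  {d | ∃ fc ∈ I, d ∈ fc.args}

/-- A distribution policy over network (node type) `K`: a universe `U` of data
values and, for each node, the set of facts (with values from `U`) it is
responsible for. -/
structure Policy (R D K : Type) where
  U : Set D
  rfacts : K → Set (DBFact R D)
  rfacts_vals : ∀ κ, ∀ fc ∈ rfacts κ, fc.valsIn U

namespace Policy
variable {R D K : Type}
/-- The local instance at node `κ`. -/
def dist (ρ : Policy R D K) (I : Set (DBFact R D)) (κ : K) : Set (DBFact R D) :=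
  I ∩ ρ.rfacts κ
end Policy

/-- `I` is an instance (finite set of facts) with values from `U`. -/
def instOver {R D : Type} (I : Set (DBFact R D)) (U : Set D) : Prop :=
  I.Finite ∧ ∀ fc ∈ I, fc.valsIn U

section Parallel
variable {R D K : Type}

/-- `q` is parallel-sound on `I` under `ρ`. -/
def parSoundOn (q : Set (DBFact R D) → Set (DBFact R D)) (ρ : Policy R D K)
    (I : Set (DBFact R D)) : Prop :=
  (⋃ κ : K, q (ρ.dist I κ)) ⊆ q I

/-- `q` is parallel-complete on `I` under `ρ`. -/
def parCompleteOn (q : Set (DBFact R D) → Set (DBFact R D)) (ρ : Policy R D K)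
    (I : Set (DBFact R D)) : Prop :=
  q I ⊆ ⋃ κ : K, q (ρ.dist I κ)

/-- `q` is parallel-correct on `I` under `ρ`. -/
def parCorrectOn (q : Set (DBFact R D) → Set (DBFact R D)) (ρ : Policy R D K)
    (I : Set (DBFact R D)) : Prop :=
  q I = ⋃ κ : K, q (ρ.dist I κ)

/-- `q` is parallel-sound under `ρ`: sound on every instance with values from
the universe of `ρ`. -/
def parSound (q : Set (DBFact R D) → Set (DBFact R D)) (ρ : Policy R D K) : Prop :=
  ∀ I : Set (DBFact R D), instOver I ρ.U → parSoundOn q ρ I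

/-- `q` is parallel-complete under `ρ`. -/
def parComplete (q : Set (DBFact R D) → Set (DBFact R D)) (ρ : Policy R D K) : Prop :=
  ∀ I : Set (DBFact R D), instOver I ρ.U → parCompleteOn q ρ I

/-- `q` is parallel-correct under `ρ`. -/
def parCorrect (q : Set (DBFact R D) → Set (DBFact R D)) (ρ : Policy R D K) : Prop :=
  ∀ I : Set (DBFact R D), instOver I ρ.U → parCorrectOn q ρ I

end Parallel

theorem Atom.app_congr {R V D : Type} {f g : V → D} {a : Atom R V}
    (h : ∀ v ∈ a.args, f v = g v) : a.app f = a.app g := by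
  simp only [Atom.app, DBFact.mk.injEq, true_and]
  exact List.map_congr_left h

/-- The prohibited facts of a full query depend only on the derived fact. -/
theorem CQ.isFull.negFacts_eq {R V D : Type} {Q : CQ R V} (hQ : Q.isFull) {f g : V → D}
    (h : Q.head.app f = Q.head.app g) : Q.negFacts f = Q.negFacts g := by
  have hvars : ∀ v ∈ Q.head.args, f v = g v := by
    simpa [Atom.app] using h
  refine Set.image_congr fun a ha => Atom.app_congr fun v hv => hvars v (hQ v ?_)
  exact Or.inl (Or.inr (Set.mem_biUnion ha hv))

theorem CQ.ncard_posFacts_le {R V D : Type} (Q : CQ R V) (f : V → D) :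
    (Q.posFacts f).ncard ≤ Q.pos.card :=
  (Set.ncard_image_le Q.pos.finite_toSet).trans_eq (Set.ncard_coe_finset _)

/-- Choosing one representative from each nonempty member of a finite family of sets. -/
theorem exists_small_transversal {ι α : Type} [Fintype ι] (P : ι → Set α) :
    ∃ T : Set α, T.ncard ≤ Fintype.card ι ∧ T ⊆ ⋃ i, P i ∧
      ∀ i, (P i).Nonempty → (P i ∩ T).Nonempty := by
  choose g hg using fun i : {i // (P i).Nonempty} => i.2
  refine ⟨Set.range g, ?_, ?_, fun i hi => ⟨g ⟨i, hi⟩, hg ⟨i, hi⟩, ⟨i, hi⟩, rfl⟩⟩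
  · rw [← Nat.card_coe_set_eq, ← Nat.card_eq_fintype_card]
    exact (Finite.card_range_le g).trans (Finite.card_subtype_le _)
  · rintro _ ⟨i, rfl⟩
    exact Set.mem_iUnion.2 ⟨i, hg i⟩

/-- A fact derived globally but at no node is still so on a small subinstance. -/
theorem exists_small_counterexample {R V D K : Type} [Fintype K] (Q : UCQ R V)
    (hfull : ∀ i, (Q.disj i).isFull) (ρ : Policy R D K) {I : Set (DBFact R D)} {f : DBFact R D}
    (hf : f ∈ Q.eval I) (hnot : ∀ κ : K, f ∉ Q.eval (ρ.dist I κ)) :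
    ∃ J ⊆ I,
      J.ncard ≤ (Finset.univ.sup fun i => (Q.disj i).pos.card) + Fintype.card K * Q.n ∧
      f ∈ Q.eval J ∧ ∀ κ : K, f ∉ Q.eval (ρ.dist J κ) := by
  obtain ⟨i, v, hval, ⟨hpos, hneg⟩, hhead⟩ := Set.mem_iUnion.1 hf
  obtain ⟨T, hTcard, hTsub, hT⟩ :=
    exists_small_transversal fun p : K × Fin Q.n =>
      {x | x ∈ ρ.dist I p.1 ∧
        ∃ w : V → D, (Q.disj p.2).head.app w = f ∧ x ∈ (Q.disj p.2).negFacts w}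
  have hTI : T ⊆ I := fun x hx => by
    obtain ⟨p, hp⟩ := Set.mem_iUnion.1 (hTsub hx)
    exact hp.1.1
  have hJ : (Q.disj i).posFacts v ∪ T ⊆ I := Set.union_subset hpos hTI
  refine ⟨(Q.disj i).posFacts v ∪ T, hJ, ?_, ?_, ?_⟩
  · refine (Set.ncard_union_le _ _).trans (Nat.add_le_add ?_ ?_)
    · exact ((Q.disj i).ncard_posFacts_le v).trans
        (Finset.le_sup (f := fun i => (Q.disj i).pos.card) (Finset.mem_univ i))
    · simpa using hTcard
  · refine Set.mem_iUnion.2 ⟨i, v, hval, ⟨Set.subset_union_left, ?_⟩, hhead⟩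
    exact Set.subset_eq_empty (Set.inter_subset_inter_right _ hJ) hneg
  · intro κ hκ
    obtain ⟨j, w, hwval, ⟨hwpos, hwneg⟩, hwhead⟩ := Set.mem_iUnion.1 hκ
    have hblocked : ((Q.disj j).negFacts w ∩ ρ.dist I κ).Nonempty := by
      by_contra hempty
      refine hnot κ (Set.mem_iUnion.2 ⟨j, w, hwval,
        ⟨hwpos.trans (Set.inter_subset_inter_left _ hJ), ?_⟩, hwhead⟩)
      exact Set.not_nonempty_iff_eq_empty.1 hempty
    obtain ⟨x, hxneg, hxI⟩ := hblocked
    obtain ⟨y, ⟨hyI, u, huhead, hyneg⟩, hyT⟩ := hT (κ, j) ⟨x, hxI, w, hwhead, hxneg⟩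
    rw [(hfull j).negFacts_eq (huhead.trans hwhead.symm)] at hyneg
    exact Set.eq_empty_iff_forall_notMem.1 hwneg y ⟨hyneg, Or.inr hyT, hyI.2⟩

/-- A full UCQ¬,≠ `Q` with `m` disjuncts is not
parallel-complete under `ρ` (over network `K`) iff there are an instance `I`
over the universe of `ρ` with `|I| ≤ maxⱼ |pos(Qⱼ)| + |K|·m` and a fact `f`
with `f ∈ Q(I)` that is derived at no node. -/
theorem full_ucq_not_parallel_complete_iff {R V D K : Type} [Infinite D] [Fintype K] [Nonempty K]
    (Q : UCQ R V) (hQ : Q.wf) (hfull : ∀ i, (Q.disj i).isFull)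
    (ρ : Policy R D K) :
    ¬ parComplete (fun I => Q.eval I) ρ ↔
      ∃ I : Set (DBFact R D), instOver I ρ.U ∧
        I.ncard ≤ (Finset.univ.sup fun i => (Q.disj i).pos.card) + Fintype.card K * Q.n ∧
        ∃ f : DBFact R D, f ∈ Q.eval I ∧ ∀ κ : K, f ∉ Q.eval (ρ.dist I κ) := by
  constructor
  · intro h
    simp only [parComplete, parCompleteOn, not_forall] at h
    obtain ⟨I, hI, h⟩ := h
    obtain ⟨f, hf, hnot⟩ := Set.not_subset.1 h
    simp only [Set.mem_iUnion, not_exists] at hnot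
    obtain ⟨J, hJI, hcard, hJf, hJnot⟩ := exists_small_counterexample Q hfull ρ hf hnot
    exact ⟨J, ⟨hI.1.subset hJI, fun fc hfc => hI.2 fc (hJI hfc)⟩, hcard, f, hJf, hJnot⟩
  · rintro ⟨I, hI, -, f, hf, hnot⟩ hcomplete
    obtain ⟨κ, hκ⟩ := Set.mem_iUnion.1 (hcomplete I hI hf)
    exact hnot κ hκ
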